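/- arXiv:2210.13174 — 3 statements merged into one kernel-verified Lean document; each statement's English description precedes it below -/
import Mathlib

section
/- Two-particle Caduceus identity in regime 1(b), boundary (1,0,0,1) (from the proof of Lemma 3.2): In ℚ(q, x₁, x₂), writing x̄ᵢ = xᵢ⁻¹, one has c₂(x₁,x₂)·c₁(x₁,x̄₂)·b₂(x̄₁,x̄₂) − q·c₂(x₁,x₂)·c₁(x̄₁,x̄₂) − q·b₁(x₁,x₂)·b₂(x̄₁,x̄₂) + q²·b₁(x₁,x₂)·c₂(x₁,x̄₂)·c₁(x̄₁,x̄₂) = −q. -/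
noncomputable section

/-- `ℚ(q, x₁, x₂)`, the field of rational functions in `q, x₁, x₂` over `ℚ`. -/
abbrev KQ : Type := FractionRing (MvPolynomial (Fin 3) ℚ)

/-- The element `q` of `ℚ(q, x₁, x₂)`. -/
def qq : KQ := algebraMap (MvPolynomial (Fin 3) ℚ) KQ (MvPolynomial.X 0)

/-- The element `x₁`. -/
def X1 : KQ := algebraMap (MvPolynomial (Fin 3) ℚ) KQ (MvPolynomial.X 1)

/-- The element `x₂`. -/
def X2 : KQ := algebraMap (MvPolynomial (Fin 3) ℚ) KQ (MvPolynomial.X 2)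

/-- R-matrix weight `b₁(u,v) = (u−v)/(u−qv)`. -/
def b1 (u v : KQ) : KQ := (u - v) / (u - qq * v)

/-- R-matrix weight `b₂(u,v) = q(u−v)/(u−qv)`. -/
def b2 (u v : KQ) : KQ := qq * (u - v) / (u - qq * v)

/-- R-matrix weight `c₁(u,v) = (1−q)u/(u−qv)`. -/
def c1 (u v : KQ) : KQ := (1 - qq) * u / (u - qq * v)

/-- R-matrix weight `c₂(u,v) = (1−q)v/(u−qv)`. -/
def c2 (u v : KQ) : KQ := (1 - qq) * v / (u - qq * v)

/-- A polynomial with a nonzero value is nonzero in the fraction field. -/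
lemma algebraMap_ne_of_eval (p : MvPolynomial (Fin 3) ℚ) (f : Fin 3 → ℚ)
    (h : MvPolynomial.eval f p ≠ 0) : algebraMap (MvPolynomial (Fin 3) ℚ) KQ p ≠ 0 := by
  intro h0
  have hp : p = 0 := (IsFractionRing.injective (MvPolynomial (Fin 3) ℚ) KQ) (by rw [h0, map_zero])
  exact h (by rw [hp, map_zero])

/-- The identity in an arbitrary field. -/
lemma caduceus_field {F : Type*} [Field F] (q a b : F) (ha : a ≠ 0) (hb : b ≠ 0)
    (h1 : a - q * b ≠ 0) (h2 : a * b - q ≠ 0) (h3 : b - q * a ≠ 0) :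
    (1 - q) * b / (a - q * b) * ((1 - q) * a / (a - q * b⁻¹))
        * (q * (a⁻¹ - b⁻¹) / (a⁻¹ - q * b⁻¹))
      - q * ((1 - q) * b / (a - q * b) * ((1 - q) * a⁻¹ / (a⁻¹ - q * b⁻¹)))
      - q * ((a - b) / (a - q * b) * (q * (a⁻¹ - b⁻¹) / (a⁻¹ - q * b⁻¹)))
      + q ^ 2 * ((a - b) / (a - q * b) * ((1 - q) * b⁻¹ / (a - q * b⁻¹))
        * ((1 - q) * a⁻¹ / (a⁻¹ - q * b⁻¹))) = -q := by
  have e2 : a - q * b⁻¹ = (a * b - q) / b := by field_simp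
  have e3 : a⁻¹ - q * b⁻¹ = (b - q * a) / (a * b) := by field_simp
  have e4 : a⁻¹ - b⁻¹ = (b - a) / (a * b) := by field_simp
  rw [e2, e3, e4]
  obtain ⟨d, hd⟩ : ∃ d, d = a * b - q := ⟨_, rfl⟩
  rw [← hd] at h2 ⊢
  field_simp
  rw [hd]
  ring

/-- Two-particle Caduceus identity in regime 1(b), boundary (1,0,0,1). -/
theorem stmt4 :
    c2 X1 X2 * c1 X1 X2⁻¹ * b2 X1⁻¹ X2⁻¹
      - qq * (c2 X1 X2 * c1 X1⁻¹ X2⁻¹)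
      - qq * (b1 X1 X2 * b2 X1⁻¹ X2⁻¹)
      + qq ^ 2 * (b1 X1 X2 * c2 X1 X2⁻¹ * c1 X1⁻¹ X2⁻¹) = -qq := by
  have ha : X1 ≠ 0 := algebraMap_ne_of_eval (MvPolynomial.X 1) ![2, 1, 3] (by simp)
  have hb : X2 ≠ 0 := algebraMap_ne_of_eval (MvPolynomial.X 2) ![2, 1, 3] (by simp)
  have h1 : X1 - qq * X2 ≠ 0 := by
    have := algebraMap_ne_of_eval
      (MvPolynomial.X 1 - MvPolynomial.X 0 * MvPolynomial.X 2) ![2, 1, 3] (by simp; norm_num)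
    rwa [map_sub, map_mul] at this
  have h2 : X1 * X2 - qq ≠ 0 := by
    have := algebraMap_ne_of_eval
      (MvPolynomial.X 1 * MvPolynomial.X 2 - MvPolynomial.X 0) ![2, 1, 3] (by simp; norm_num)
    rwa [map_sub, map_mul] at this
  have h3 : X2 - qq * X1 ≠ 0 := by
    have := algebraMap_ne_of_eval
      (MvPolynomial.X 2 - MvPolynomial.X 0 * MvPolynomial.X 1) ![2, 1, 3] (by simp; norm_num)
    rwa [map_sub, map_mul] at this
  exact caduceus_field qq X1 X2 ha hb h1 h2 h3
end
end

section
/- Three-particle Caduceus identities in regime 1(a) (from the proof of Lemma 3.3): (a) For all u, u', v in a field containing q with u − qv ≠ 0 and u' − qv ≠ 0, one has c₂(u,v) + c₂(u',v)·b₁(u,v) + b₁(u',v)·b₁(u,v) = 1. (b) In ℚ(q, x₁, x₂), writing x̄ᵢ = xᵢ⁻¹, one has c₂(x̄₁,x₂)·b₂(x̄₁,x̄₂) + c₂(x₁,x̄₂)·c₂(x̄₁,x₂)·c₁(x̄₁,x̄₂) + c₂(x₁,x₂)·b₂(x₁,x̄₂)·b₁(x̄₁,x₂) + b₁(x₁,x̄₂)·c₂(x̄₁,x₂)·c₁(x̄₁,x̄₂)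 + c₂(x₁,x₂)·c₁(x₁,x̄₂)·b₁(x̄₁,x₂) + b₁(x₁,x₂)·b₁(x̄₁,x₂) = 1. Together these show that in regime 1(a) with C₂D₁ = C₁D₂ the three-particle caduceus relation holds with constant of proportionality F = 1 for the boundary conditions (1,1,1,0) and (1,1,0,1). -/
noncomputable section

/-- A polynomial not vanishing at `(q, x₁, x₂) = (0, 1, 1)` is nonzero in `KQ`. -/
theorem algebraMap_ne_zero_of_eval (p : MvPolynomial (Fin 3) ℚ)
    (h : MvPolynomial.eval ![0, 1, 1] p ≠ 0) :
    algebraMap (MvPolynomial (Fin 3) ℚ) KQ p ≠ 0 := by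
  intro h0
  have : p = 0 := (IsFractionRing.injective (MvPolynomial (Fin 3) ℚ) KQ) (by simpa using h0)
  exact h (by simp [this])

theorem X1_ne : X1 ≠ 0 := algebraMap_ne_zero_of_eval _ (by simp)

theorem X2_ne : X2 ≠ 0 := algebraMap_ne_zero_of_eval _ (by simp)

theorem den1 : X1 - qq * X2 ≠ 0 := by
  have := algebraMap_ne_zero_of_eval
    (MvPolynomial.X 1 - MvPolynomial.X 0 * MvPolynomial.X 2) (by simp)
  rwa [map_sub, map_mul] at this

theorem den2 : X1⁻¹ - qq * X2 ≠ 0 := by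
  have := algebraMap_ne_zero_of_eval
    (1 - MvPolynomial.X 0 * MvPolynomial.X 2 * MvPolynomial.X 1) (by simp)
  rw [map_sub, map_mul, map_mul, map_one] at this
  change 1 - qq * X2 * X1 ≠ 0 at this
  intro h
  apply this
  have h1 := X1_ne
  calc 1 - qq * X2 * X1 = (X1⁻¹ - qq * X2) * X1 := by rw [sub_mul, inv_mul_cancel₀ h1]
    _ = 0 := by rw [h, zero_mul]

theorem den3 : X1 - qq * X2⁻¹ ≠ 0 := by
  have := algebraMap_ne_zero_of_eval
    (MvPolynomial.X 1 * MvPolynomial.X 2 - MvPolynomial.X 0) (by simp)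
  rw [map_sub, map_mul] at this
  change X1 * X2 - qq ≠ 0 at this
  intro h
  apply this
  have h2 := X2_ne
  calc X1 * X2 - qq = (X1 - qq * X2⁻¹) * X2 := by
        rw [sub_mul, mul_assoc qq, inv_mul_cancel₀ h2, mul_one]
    _ = 0 := by rw [h, zero_mul]

theorem den4 : X1⁻¹ - qq * X2⁻¹ ≠ 0 := by
  have := algebraMap_ne_zero_of_eval
    (MvPolynomial.X 2 - MvPolynomial.X 0 * MvPolynomial.X 1) (by simp)
  rw [map_sub, map_mul] at this
  change X2 - qq * X1 ≠ 0 at this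
  intro h
  apply this
  have h1 := X1_ne
  have h2 := X2_ne
  calc X2 - qq * X1 = (X1⁻¹ - qq * X2⁻¹) * (X1 * X2) := by field_simp
    _ = 0 := by rw [h, zero_mul]

theorem c2_add_b1 (u v : KQ) (h : u - qq * v ≠ 0) : c2 u v + b1 u v = 1 := by
  unfold c2 b1
  rw [← add_div, div_eq_one_iff_eq h]
  ring

theorem b2_add_c1 (u v : KQ) (h : u - qq * v ≠ 0) : b2 u v + c1 u v = 1 := by
  unfold b2 c1
  rw [← add_div, div_eq_one_iff_eq h]
  ring

/-- Three-particle Caduceus identities in regime 1(a): (a) a general-field identity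
evaluating the boundary `(1,1,1,0)` partition function, and (b) the identity evaluating
the boundary `(1,1,0,1)` partition function in `ℚ(q,x₁,x₂)`. -/
theorem stmt7 :
    (∀ (G : Type) [Field G] (q u u' v : G), u - q * v ≠ 0 → u' - q * v ≠ 0 →
      (1 - q) * v / (u - q * v)
        + ((1 - q) * v / (u' - q * v)) * ((u - v) / (u - q * v))
        + ((u' - v) / (u' - q * v)) * ((u - v) / (u - q * v)) = 1) ∧
    (c2 X1⁻¹ X2 * b2 X1⁻¹ X2⁻¹
      + c2 X1 X2⁻¹ * c2 X1⁻¹ X2 * c1 X1⁻¹ X2⁻¹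
      + c2 X1 X2 * b2 X1 X2⁻¹ * b1 X1⁻¹ X2
      + b1 X1 X2⁻¹ * c2 X1⁻¹ X2 * c1 X1⁻¹ X2⁻¹
      + c2 X1 X2 * c1 X1 X2⁻¹ * b1 X1⁻¹ X2
      + b1 X1 X2 * b1 X1⁻¹ X2 = 1) := by
  constructor
  · intro G _ q u u' v h h'
    have e : (1 - q) * v / (u - q * v) + (u - v) / (u - q * v) = 1 := by
      rw [← add_div, div_eq_one_iff_eq h]
      ring
    have e' : (1 - q) * v / (u' - q * v) + (u' - v) / (u' - q * v) = 1 := by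
      rw [← add_div, div_eq_one_iff_eq h']
      ring
    linear_combination e + (u - v) / (u - q * v) * e'
  · have e1 := c2_add_b1 _ _ den1
    have e2 := c2_add_b1 _ _ den2
    have e3 := c2_add_b1 _ _ den3
    have e4 := b2_add_c1 _ _ den4
    have e5 := b2_add_c1 _ _ den3
    linear_combination c2 X1⁻¹ X2 * c1 X1⁻¹ X2⁻¹ * e3 + c2 X1⁻¹ X2 * e4
      + c2 X1 X2 * b1 X1⁻¹ X2 * e5 + b1 X1⁻¹ X2 * e1 + e2
end
end

section
/- Rank-one evaluation, antisymmetric cases (Theorem 5.1, cases (1b) and (2a)): Consider the type B/C lattice model of rank 1 with partition λ = (λ₁), λ₁ ≥ 0, and bend weights that are Laurent monomials in x₁ with coefficients in ℂ[q] (or zero), with A₁ = D₁ = 0. (1b) If B₁ = −q·C₁, then Z_λ = C₁ · (1 − q·x₁⁻²)/(1 − x₁⁻²) · ( x₁^{λ₁+1} − x₁^{−λ₁−1} ); that is, Z_λ = C₁·(1 − q·x₁⁻²)/(1 − x₁⁻²)·Σ_{w∈W₀} (−1)^{ℓ(w)} w( x₁^{λ₁+1} ), where W₀ = {identity, x₁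 ↦ x₁⁻¹} with lengths 0 and 1. (2a) If B₁ = −x₁²·C₁, then Z_λ = C₁·x₁ · (1 − q·x₁⁻²)/(1 − x₁⁻²) · ( x₁^{λ₁} − x₁^{−λ₁} ). -/
noncomputable section

/-- Bosonic six-vertex Boltzmann weight `w_z(h_l, h_r, a, b)` (left horizontal label,
right horizontal label, top vertical multiplicity, bottom vertical multiplicity). -/
def sixw {F : Type} [Field F] (q z : F) : Bool → Bool → ℕ → ℕ → F
  | false, false, a, b => if a = b then 1 else 0
  | true,  true,  a, b => if a = b then z else 0
  | false, true,  a, b => if a = b + 1 then 1 - q ^ a else 0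
  | true,  false, a, b => if b = a + 1 then z else 0

/-- Bend weight selector; the arguments are the left-boundary labels of the two rows
meeting the bend (top row of the pair first, bottom row second). -/
def bendw {F : Type} [Field F] (A B C D : F) : Bool → Bool → F
  | false, false => A
  | true,  false => C
  | false, true  => B
  | true,  true  => D

/-- A state of the type B/C lattice model of rank `r` with bottom boundary given by the
partition `lam` and `L+1` columns: `m s c` is the multiplicity on the vertical edge
below row `s` (0-indexed from the bottom) in column `c`, and `h s c` is the occupancy of
the horizontal edge to the left of column `c` in row `s`. -/
structure BCState (r : ℕ) (lam : Fin r → ℕ) (L : ℕ) where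
  m : Fin (2*r+1) → Fin (L+1) → ℕ
  h : Fin (2*r) → Fin (L+2) → Bool
  bottom : ∀ c : Fin (L+1), m 0 c = (Finset.univ.filter (fun i => lam i = c.val)).card
  top : ∀ c : Fin (L+1), m (Fin.last (2*r)) c = 0
  right : ∀ s : Fin (2*r), h s (Fin.last (L+1)) = false

/-- The spectral parameter of row `s` (0-indexed from the bottom): row `2i-1` (1-indexed)
carries `xᵢ⁻¹` and row `2i` carries `xᵢ`. -/
def rowp {F : Type} [Field F] {r : ℕ} (x : Fin r → F) (s : Fin (2*r)) : F :=
  if s.val % 2 = 0 then (x ⟨s.val / 2, by have := s.isLt; omega⟩)⁻¹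
  else x ⟨s.val / 2, by have := s.isLt; omega⟩

/-- The Boltzmann weight of a state: the product of the six-vertex weights at all
tetravalent vertices times the product of the bend weights. -/
def stateWeight {F : Type} [Field F] {r : ℕ} {lam : Fin r → ℕ} {L : ℕ}
    (q : F) (x : Fin r → F) (A B C D : Fin r → F) (st : BCState r lam L) : F :=
  (∏ s : Fin (2*r), ∏ c : Fin (L+1),
      sixw q (rowp x s) (st.h s c.castSucc) (st.h s c.succ)
        (st.m s.succ c) (st.m s.castSucc c)) *
  ∏ i : Fin r,
      bendw (A i) (B i) (C i) (D i)
        (st.h ⟨2*i.val+1, by have := i.isLt; omega⟩ 0)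
        (st.h ⟨2*i.val, by have := i.isLt; omega⟩ 0)

/-- The partition function of the type B/C lattice model: the sum of the weights of all
states (only finitely many have nonzero weight). -/
def ZBC {F : Type} [Field F] {r : ℕ} (lam : Fin r → ℕ) (L : ℕ)
    (q : F) (x : Fin r → F) (A B C D : Fin r → F) : F :=
  ∑ᶠ st : BCState r lam L, stateWeight q x A B C D st

/-- `ℂ(q, x₁)`. -/
abbrev F1 : Type := FractionRing (MvPolynomial (Fin 2) ℂ)

/-- The element `q` of `ℂ(q, x₁)`. -/
def q1 : F1 := algebraMap (MvPolynomial (Fin 2) ℂ) F1 (MvPolynomial.X 0)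

/-- The element `x₁` of `ℂ(q, x₁)`. -/
def x1 : F1 := algebraMap (MvPolynomial (Fin 2) ℂ) F1 (MvPolynomial.X 1)

/-- The embedding of the constants `ℂ` into `ℂ(q, x₁)`. -/
def cC1 : ℂ →+* F1 :=
  (algebraMap (MvPolynomial (Fin 2) ℂ) F1).comp MvPolynomial.C

/-- `a` is a Laurent monomial in `x₁` with coefficient in `ℂ[q]`,
i.e. `a = c·x₁ⁿ` with `c ∈ ℂ[q]` nonzero and `n ∈ ℤ`. -/
def LMono (a : F1) : Prop :=
  ∃ (p : Polynomial ℂ) (n : ℤ),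
    p ≠ 0 ∧ a = Polynomial.eval₂ cC1 q1 p * x1 ^ n

/-- The partition function of the rank-one type B/C model with `λ = (l)` and bend
weights `A, B, C, D`. -/
def Z1 (l : ℕ) (A B C D : F1) : F1 :=
  ZBC (fun _ : Fin 1 => l) l q1 (fun _ => x1)
    (fun _ => A) (fun _ => B) (fun _ => C) (fun _ => D)

/-- The state of the rank-one model indexed by `j ≤ l+1`. -/
def stJ (l : ℕ) (j : ℕ) (hj : j < l + 2) : BCState 1 (fun _ => l) l where
  m := fun s c => if s.val = 0 then (if c.val = l then 1 else 0)
    else if s.val = 1 then (if c.val + 1 = j then 1 else 0) else 0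
  h := fun s c => if s.val = 0 then decide (j ≤ c.val ∧ c.val ≤ l) else decide (c.val < j)
  bottom := by
    intro c
    by_cases h : c.val = l
    · simp [h]
    · have h' : ¬ l = c.val := fun e => h e.symm
      simp [h, h']
  top := by intro c; simp
  right := by
    intro s
    have : ¬ (l + 1 < j) := by omega
    simp [this]

lemma BCState_ext {r : ℕ} {lam : Fin r → ℕ} {L : ℕ} {s t : BCState r lam L}
    (hm : s.m = t.m) (hh : s.h = t.h) : s = t := by
  cases s; cases t; simp_all

lemma sixw_cons {F : Type} [Field F] (q z : F) (a b : Bool) (m n : ℕ)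
    (h : sixw q z a b m n ≠ 0) : b.toNat + n = a.toNat + m := by
  cases a <;> cases b <;> simp [sixw] at h <;> simp <;> omega

lemma prod_lt_pow {F : Type} [Field F] (x : F) (j n : ℕ) :
    ∏ c ∈ Finset.range n, (if c < j then x else 1) = x ^ (min j n) := by
  induction n with
  | zero => simp
  | succ n ih =>
    rw [Finset.prod_range_succ, ih]
    by_cases h : n < j
    · rw [if_pos h, min_eq_right (by omega), min_eq_right (by omega), pow_succ]
    · rw [if_neg h, min_eq_left (by omega), min_eq_left (by omega), mul_one]

lemma prod_ge_pow {F : Type} [Field F] (x : F) (j n : ℕ) :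
    ∏ c ∈ Finset.range n, (if j ≤ c then x else 1) = x ^ (n - j) := by
  induction n with
  | zero => simp
  | succ n ih =>
    rw [Finset.prod_range_succ, ih]
    by_cases h : j ≤ n
    · rw [if_pos h, ← pow_succ]; congr 1; omega
    · rw [if_neg h, mul_one]; congr 1; omega

lemma prod_eq_one_pt {F : Type} [Field F] (t : F) (j n : ℕ) :
    ∏ c ∈ Finset.range n, (if c + 1 = j then t else 1) = if 1 ≤ j ∧ j ≤ n then t else 1 := by
  induction n with
  | zero =>
    have : ¬ (1 ≤ j ∧ j ≤ 0) := by omega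
    rw [if_neg this]; simp
  | succ n ih =>
    rw [Finset.prod_range_succ, ih]
    by_cases h : n + 1 = j
    · rw [if_pos h, if_neg (by omega), if_pos (by omega), one_mul]
    · rw [if_neg h, mul_one]
      by_cases h2 : 1 ≤ j ∧ j ≤ n
      · rw [if_pos h2, if_pos (by omega)]
      · rw [if_neg h2, if_neg (by omega)]

lemma stJ_weight {F : Type} [Field F] (q x A B C D : F) (l j : ℕ) (hj : j < l + 2) :
    stateWeight q (fun _ => x) (fun _ => A) (fun _ => B) (fun _ => C) (fun _ => D) (stJ l j hj)
    = (x⁻¹ ^ (l + 1 - j) * (if 1 ≤ j ∧ j ≤ l + 1 then (if j = l + 1 then 1 else 1 - q) else 1))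
      * x ^ j * (if j = 0 then B else C) := by
  unfold stateWeight
  have e2 : ∀ f : Fin (2*1) → F, ∏ s, f s = f 0 * f 1 := fun f => Fin.prod_univ_two f
  rw [e2]
  have h1 : ∏ c : Fin (l+1), sixw q (rowp (fun _ : Fin 1 => x) 0) ((stJ l j hj).h 0 c.castSucc)
      ((stJ l j hj).h 0 c.succ) ((stJ l j hj).m (Fin.succ 0) c) ((stJ l j hj).m (Fin.castSucc 0) c)
      = x⁻¹ ^ (l + 1 - j) *
        (if 1 ≤ j ∧ j ≤ l + 1 then (if j = l + 1 then 1 else 1 - q) else 1) := by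
    rw [← prod_ge_pow, ← prod_eq_one_pt, ← Finset.prod_mul_distrib, ← Fin.prod_univ_eq_prod_range
      (fun c => (if j ≤ c then x⁻¹ else 1) * (if c + 1 = j then (if j = l + 1 then 1 else 1 - q) else 1))]
    refine Finset.prod_congr rfl fun c _ => ?_
    have hc := c.isLt
    have hr : rowp (fun _ : Fin 1 => x) 0 = x⁻¹ := by simp [rowp]
    rw [hr]
    simp only [stJ, Fin.val_succ, Fin.val_castSucc, Fin.val_zero]
    by_cases a1 : j ≤ c.val <;> by_cases a2 : c.val + 1 = j <;> by_cases a3 : c.val = l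
      <;> try omega
    · have : j ≤ l := by omega
      have b : ¬ l + 1 = j := by omega
      simp [a3, sixw, this, b]
    · have : c.val ≤ l := by omega
      have b : c.val + 1 ≤ l := by omega
      have b2 : j ≤ c.val + 1 := by omega
      simp [a1, a2, a3, sixw, this, b, b2]
    · subst a2
      simp [a3, sixw]
    · subst a2
      have b : c.val + 1 ≤ l := by omega
      simp [a3, sixw, b]
    · have b2 : ¬ j ≤ c.val + 1 := by omega
      simp [a1, a2, a3, sixw, b2]
  have h2 : ∏ c : Fin (l+1), sixw q (rowp (fun _ : Fin 1 => x) 1) ((stJ l j hj).h 1 c.castSucc)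
      ((stJ l j hj).h 1 c.succ) ((stJ l j hj).m (Fin.succ 1) c) ((stJ l j hj).m (Fin.castSucc 1) c)
      = x ^ j := by
    have : x ^ j = x ^ (min j (l+1)) := by rw [min_eq_left (by omega)]
    rw [this, ← prod_lt_pow, ← Fin.prod_univ_eq_prod_range (fun c => if c < j then x else 1)]
    refine Finset.prod_congr rfl fun c _ => ?_
    have hc := c.isLt
    have hr : rowp (fun _ : Fin 1 => x) 1 = x := by simp [rowp]
    rw [hr]
    simp only [stJ, Fin.val_succ, Fin.val_castSucc]
    by_cases a1 : c.val < j <;> by_cases a2 : c.val + 1 = j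
    · subst a2
      simp [sixw]
    · have : c.val + 1 < j := by omega
      simp [sixw, a1, a2, this]
    · omega
    · have : ¬ c.val + 1 < j := by omega
      simp [sixw, a1, a2, this]
  rw [h1, h2]
  congr 1
  by_cases h0 : j = 0
  · subst h0; simp [stJ, bendw]
  · have : 0 < j := by omega
    simp [stJ, bendw, h0, this]

lemma stJ_inj (l j k : ℕ) (hj : j < l + 2) (hk : k < l + 2) (h : stJ l j hj = stJ l k hk) :
    j = k := by
  have h1 : ∀ c : Fin (l+2), (c.val < j ↔ c.val < k) := by
    intro c
    have := congrArg (fun s => s.h 1 c) h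
    simpa [stJ] using this
  by_contra hne
  rcases lt_or_gt_of_ne hne with hl | hl
  · have := h1 ⟨j, hj⟩
    simp at this; omega
  · have := h1 ⟨k, hk⟩
    simp at this; omega

lemma stJ_surj {F : Type} [Field F] (q x A B C D : F) (l : ℕ) (st : BCState 1 (fun _ => l) l)
    (h : stateWeight q (fun _ => x) (fun _ => A) (fun _ => B) (fun _ => C) (fun _ => D) st ≠ 0) :
    ∃ j : Fin (l + 2), stJ l j.val j.isLt = st := by
  have hv : ∀ s c, (st.h s c.succ).toNat + st.m s.castSucc c
      = (st.h s c.castSucc).toNat + st.m s.succ c := by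
    intro s c
    unfold stateWeight at h
    have h1 := left_ne_zero_of_mul h
    have h2 := Finset.prod_ne_zero_iff.1 h1 s (Finset.mem_univ _)
    exact sixw_cons _ _ _ _ _ _ (Finset.prod_ne_zero_iff.1 h2 c (Finset.mem_univ _))
  -- the labels as functions on the naturals
  let h0 : ℕ → ℕ := fun c => if hc : c < l + 2 then (st.h 0 ⟨c, hc⟩).toNat else 0
  let h1 : ℕ → ℕ := fun c => if hc : c < l + 2 then (st.h 1 ⟨c, hc⟩).toNat else 0
  let m1 : ℕ → ℕ := fun c => if hc : c < l + 1 then st.m 1 ⟨c, hc⟩ else 0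
  have e0 : ∀ c, c < l + 1 → h0 (c+1) + (if c = l then 1 else 0) = h0 c + m1 c := by
    intro c hc
    have := hv 0 ⟨c, hc⟩
    have hb := st.bottom ⟨c, hc⟩
    have hb' : st.m 0 ⟨c, hc⟩ = if c = l then 1 else 0 := by
      rw [hb]
      by_cases e : c = l
      · simp [e]
      · have e' : ¬ l = c := fun t => e t.symm
        simp [e, e']
    have g1 : c + 1 < l + 2 := by omega
    have g2 : c < l + 2 := by omega
    simp only [h0, m1, dif_pos g1, dif_pos g2, dif_pos hc]
    rw [← hb']
    exact this
  have e1 : ∀ c, c < l + 1 → h1 (c+1) + m1 c = h1 c := by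
    intro c hc
    have := hv 1 ⟨c, hc⟩
    have ht : st.m (Fin.succ 1) ⟨c, hc⟩ = 0 := st.top ⟨c, hc⟩
    rw [ht] at this
    have g1 : c + 1 < l + 2 := by omega
    have g2 : c < l + 2 := by omega
    simp only [h1, m1, dif_pos g1, dif_pos g2, dif_pos hc]
    exact this
  have r0 : h0 (l+1) = 0 := by
    have := st.right 0
    simp only [h0, dif_pos (Nat.lt_succ_self (l+1))]
    have e : st.h 0 ⟨l+1, Nat.lt_succ_self (l+1)⟩ = false := this
    rw [e]; rfl
  have r1 : h1 (l+1) = 0 := by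
    have := st.right 1
    simp only [h1, dif_pos (Nat.lt_succ_self (l+1))]
    have e : st.h 1 ⟨l+1, Nat.lt_succ_self (l+1)⟩ = false := this
    rw [e]; rfl
  have b1 : ∀ c, h1 c ≤ 1 := by
    intro c
    simp only [h1]
    split
    · exact Bool.toNat_le _
    · omega
  have hsum : ∀ d, d ≤ l → h0 (l - d) + h1 (l - d) = 1 := by
    intro d
    induction d with
    | zero =>
      intro _
      have a := e0 l (by omega)
      have b := e1 l (by omega)
      simp at a ⊢; omega
    | succ d ih =>
      intro hd
      have i := ih (by omega)
      have a := e0 (l - (d+1)) (by omega)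
      have b := e1 (l - (d+1)) (by omega)
      have k : l - (d+1) + 1 = l - d := by omega
      rw [k] at a b
      rw [if_neg (by omega)] at a
      omega
  have hsum' : ∀ c, c ≤ l → h0 c + h1 c = 1 := by
    intro c hc
    have := hsum (l - c) (by omega)
    rwa [show l - (l - c) = c by omega] at this
  have hex : ∃ c, h1 c = 0 := ⟨l+1, r1⟩
  classical
  obtain ⟨j, hj0, hjm⟩ : ∃ j, h1 j = 0 ∧ ∀ c, c < j → h1 c ≠ 0 :=
    ⟨Nat.find hex, Nat.find_spec hex, fun c hc => Nat.find_min hex hc⟩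
  have hjl : j < l + 2 := by
    by_contra hcon
    exact hjm (l+1) (by omega) r1
  have hup : ∀ d, j + d < l + 2 → h1 (j + d) = 0 := by
    intro d
    induction d with
    | zero => intro _; exact hj0
    | succ d ih =>
      intro hd
      have i := ih (by omega)
      have b := e1 (j + d) (by omega)
      rw [← add_assoc]; omega
  have hchar : ∀ c, c < l + 2 → h1 c = if c < j then 1 else 0 := by
    intro c hc
    by_cases hcj : c < j
    · rw [if_pos hcj]; have := hjm c hcj; have := b1 c; omega
    · rw [if_neg hcj]
      have := hup (c - j) (by omega)
      rwa [show j + (c - j) = c by omega] at this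
  have hchar0 : ∀ c, c < l + 2 → h0 c = if j ≤ c ∧ c ≤ l then 1 else 0 := by
    intro c hc
    by_cases hcl : c ≤ l
    · have a := hsum' c hcl
      rw [hchar c hc] at a
      split_ifs at a ⊢ <;> omega
    · have : c = l + 1 := by omega
      subst this
      rw [r0, if_neg (by omega)]
  refine ⟨⟨j, hjl⟩, BCState_ext ?_ ?_⟩
  · funext s c
    obtain ⟨s, hs⟩ := s
    obtain ⟨c, hc⟩ := c
    have hs' : s = 0 ∨ s = 1 ∨ s = 2 := by omega
    rcases hs' with rfl | rfl | rfl
    · exact ((stJ l j hjl).bottom ⟨c, hc⟩).trans (st.bottom ⟨c, hc⟩).symm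
    · have a := e1 c hc
      rw [hchar c (by omega), hchar (c+1) (by omega)] at a
      have g : m1 c = st.m ⟨1, hs⟩ ⟨c, hc⟩ := by
        simp only [m1, dif_pos hc]; rfl
      rw [← g]
      simp only [stJ]
      rw [if_neg (by omega), if_pos trivial]
      split_ifs at a ⊢ <;> omega
    · exact ((stJ l j hjl).top ⟨c, hc⟩).trans (st.top ⟨c, hc⟩).symm
  · funext s c
    obtain ⟨s, hs⟩ := s
    obtain ⟨c, hc⟩ := c
    have hs' : s = 0 ∨ s = 1 := by omega
    rcases hs' with rfl | rfl
    · have a := hchar0 c hc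
      have g : h0 c = (st.h ⟨0, hs⟩ ⟨c, hc⟩).toNat := by
        simp only [h0, dif_pos hc]; rfl
      rw [g] at a
      simp only [stJ]
      cases hb : st.h ⟨0, hs⟩ ⟨c, hc⟩ <;> rw [hb] at a <;> simp at a ⊢ <;> omega
    · have a := hchar c hc
      have g : h1 c = (st.h ⟨1, hs⟩ ⟨c, hc⟩).toNat := by
        simp only [h1, dif_pos hc]; rfl
      rw [g] at a
      simp only [stJ]
      cases hb : st.h ⟨1, hs⟩ ⟨c, hc⟩ <;> rw [hb] at a <;> simp at a ⊢ <;> omega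

lemma ZBC_one {F : Type} [Field F] (q x A B C D : F) (l : ℕ) :
    ZBC (fun _ : Fin 1 => l) l q (fun _ => x) (fun _ => A) (fun _ => B) (fun _ => C) (fun _ => D)
    = B * x⁻¹ ^ (l + 1) + C * x ^ (l + 1)
      + C * (1 - q) * ∑ j ∈ Finset.range l, x⁻¹ ^ (l - j) * x ^ (j + 1) := by
  classical
  unfold ZBC
  rw [finsum_eq_sum_of_support_subset (s := Finset.univ.image
    (fun j : Fin (l + 2) => stJ l j.val j.isLt))]
  · rw [Finset.sum_image]
    · simp only [stJ_weight]
      rw [Fin.sum_univ_eq_sum_range (fun j => (x⁻¹ ^ (l + 1 - j) *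
        (if 1 ≤ j ∧ j ≤ l + 1 then (if j = l + 1 then 1 else 1 - q) else 1))
        * x ^ j * (if j = 0 then B else C)), Finset.sum_range_succ, Finset.sum_range_succ']
      have : ∑ j ∈ Finset.range l, x⁻¹ ^ (l + 1 - (j + 1)) *
          (if 1 ≤ j + 1 ∧ j + 1 ≤ l + 1 then (if j + 1 = l + 1 then 1 else 1 - q) else 1)
          * x ^ (j + 1) * (if j + 1 = 0 then B else C)
          = C * (1 - q) * ∑ j ∈ Finset.range l, x⁻¹ ^ (l - j) * x ^ (j + 1) := by
        rw [Finset.mul_sum]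
        refine Finset.sum_congr rfl fun j hj => ?_
        have := Finset.mem_range.1 hj
        rw [if_pos (by omega), if_neg (by omega), if_neg (by omega),
          show l + 1 - (j + 1) = l - j by omega]
        ring
      rw [this]
      simp
      ring
    · intro a _ b _ hab
      exact Fin.ext (stJ_inj l _ _ _ _ hab)
  · intro st hst
    obtain ⟨j, hj⟩ := stJ_surj q x A B C D l st hst
    simp only [Finset.coe_image, Finset.coe_univ, Set.image_univ, Set.mem_range]
    exact ⟨j, hj⟩

lemma geom_aux {F : Type} [Field F] (x : F) (hx : x ≠ 0) (l : ℕ) :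
    (x ^ 2 - 1) * ∑ j ∈ Finset.range l, x⁻¹ ^ (l - j) * x ^ (j + 1)
      = x ^ (l + 1) - x * x * x⁻¹ ^ (l + 1) := by
  induction l with
  | zero => simp [hx]
  | succ l ih =>
    rw [Finset.sum_range_succ]
    have : ∑ j ∈ Finset.range l, x⁻¹ ^ (l + 1 - j) * x ^ (j + 1)
        = x⁻¹ * ∑ j ∈ Finset.range l, x⁻¹ ^ (l - j) * x ^ (j + 1) := by
      rw [Finset.mul_sum]
      refine Finset.sum_congr rfl fun j hj => ?_
      have := Finset.mem_range.1 hj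
      rw [show l + 1 - j = (l - j) + 1 by omega]
      ring
    rw [this, show l + 1 - l = 1 by omega, mul_add, mul_left_comm, ih]
    have hxx : x * x⁻¹ = 1 := mul_inv_cancel₀ hx
    linear_combination x ^ (l + 2) * hxx

lemma x1_ne : x1 ≠ 0 := by
  unfold x1
  rw [Ne, IsFractionRing.to_map_eq_zero_iff]
  exact MvPolynomial.X_ne_zero _

lemma x1_sq_ne : x1 ^ 2 - 1 ≠ 0 := by
  intro h
  unfold x1 at h
  rw [← map_pow, ← map_one (algebraMap (MvPolynomial (Fin 2) ℂ) F1), ← map_sub,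
    IsFractionRing.to_map_eq_zero_iff] at h
  have := congrArg (MvPolynomial.eval (fun _ => (0:ℂ))) h
  simp at this

/-- Rank-one evaluation, antisymmetric cases (Theorem 5.1, cases (1b) and (2a)). -/
theorem stmt11 (l : ℕ) (A B C D : F1)
    (hA : A = 0) (hD : D = 0)
    (hB : B = 0 ∨ LMono B) (hC : C = 0 ∨ LMono C) :
    (B = -q1 * C →
      Z1 l A B C D
        = C * ((1 - q1 * (x1 ^ 2)⁻¹) / (1 - (x1 ^ 2)⁻¹))
            * (x1 ^ (l + 1) - x1⁻¹ ^ (l + 1))) ∧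
    (B = -(x1 ^ 2) * C →
      Z1 l A B C D
        = C * x1 * ((1 - q1 * (x1 ^ 2)⁻¹) / (1 - (x1 ^ 2)⁻¹))
            * (x1 ^ l - x1⁻¹ ^ l)) := by
  have hx := x1_ne
  have hx2 := x1_sq_ne
  have hg := geom_aux x1 hx l
  have hd : (1 - q1 * (x1 ^ 2)⁻¹) / (1 - (x1 ^ 2)⁻¹) = (x1 ^ 2 - q1) / (x1 ^ 2 - 1) := by
    have : 1 - (x1 ^ 2)⁻¹ = (x1 ^ 2 - 1) * (x1 ^ 2)⁻¹ := by field_simp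
    have h2 : 1 - q1 * (x1 ^ 2)⁻¹ = (x1 ^ 2 - q1) * (x1 ^ 2)⁻¹ := by field_simp
    rw [this, h2, mul_div_mul_right]
    exact inv_ne_zero (pow_ne_zero _ hx)
  have hy : x1⁻¹ ^ l = x1 * x1⁻¹ ^ (l + 1) := by
    rw [pow_succ]; field_simp
  unfold Z1
  rw [ZBC_one, hd]
  refine ⟨fun h => ?_, fun h => ?_⟩
  · rw [h]
    apply mul_left_cancel₀ hx2
    trans C * (x1 ^ 2 - q1) * (x1 ^ (l + 1) - x1⁻¹ ^ (l + 1))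
    · linear_combination (C * (1 - q1)) * hg
    · field_simp
  · rw [h, hy]
    apply mul_left_cancel₀ hx2
    trans C * x1 * (x1 ^ 2 - q1) * (x1 ^ l - x1 * x1⁻¹ ^ (l + 1))
    · linear_combination (C * (1 - q1)) * hg
    · field_simp
end
end
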